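/- Suppose the discount-adjusted spectral radius satisfies e^{−δ} s(L) < 1, where δ ≥ 0 and L(z,z') = Φ(z,z')E[m(z',ε)] as above. Then there exist N ∈ ℕ and α ∈ (0,1) such that for all n ≥ N, max_{z ∈ Z} E_z[∏_{t=1}^n e^{−δ} M_t] < αⁿ. Consequently the sum D₁ = Σ_{t=0}^∞ max_{z∈Z} E_z[∏_{i=1}^t e^{−δ} M_i] is finite. -/

import Mathlib

open MeasureTheory

/-- Path expectation `E_z[∏_{t=1}^n M_t · h(Z_n)]` (innovations integrated out). -/
noncomputable def pathExp {Z : Type*} [Fintype Z] (Φ : Z → Z → ℝ) (mbar : Z → ℝ)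
    (n : ℕ) (h : Z → ℝ) (z : Z) : ℝ :=
  ∑ ω : Fin n → Z,
    (∏ i : Fin n,
      Φ (if hi : (i : ℕ) = 0 then z
         else ω ⟨(i : ℕ) - 1, lt_of_le_of_lt (Nat.sub_le _ _) i.isLt⟩) (ω i)
        * mbar (ω i)) *
    (if hn : n = 0 then h z
     else h (ω ⟨n - 1, Nat.sub_lt (Nat.pos_of_ne_zero hn) Nat.one_pos⟩))

/-- Spectral radius of a real square matrix. -/
noncomputable def specRad {Z : Type*} [Fintype Z] [DecidableEq Z] (L : Matrix Z Z ℝ) : ℝ :=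
  (spectralRadius ℝ (LinearMap.toContinuousLinearMap (Matrix.toEuclideanLin L))).toReal

open Filter Topology

theorem pathExp_one_succ {Z : Type*} [Fintype Z] (Φ : Z → Z → ℝ) (mbar : Z → ℝ) (n : ℕ) (z : Z) :
    pathExp Φ mbar (n + 1) (fun _ => 1) z =
      ∑ z', Φ z z' * mbar z' * pathExp Φ mbar n (fun _ => 1) z' := by
  simp only [pathExp, dite_eq_ite, ite_self, mul_one, Finset.mul_sum]
  rw [← (Fin.consEquiv fun _ : Fin (n + 1) => Z).sum_comp, Fintype.sum_prod_type]
  refine Finset.sum_congr rfl fun z' _ => Finset.sum_congr rfl fun ω _ => ?_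
  rw [Fin.prod_univ_succ]
  congr 1
  refine Finset.prod_congr rfl fun i _ => ?_
  obtain ⟨_ | j, _⟩ := i <;>
    simp only [Fin.val_succ, Nat.add_eq_zero_iff, one_ne_zero, and_false] <;> rfl

theorem pathExp_one_eq_pow {Z : Type*} [Fintype Z] [DecidableEq Z] (Φ : Z → Z → ℝ) (mbar : Z → ℝ)
    (L : Matrix Z Z ℝ) (hL : ∀ z z', L z z' = Φ z z' * mbar z') (n : ℕ) (z : Z) :
    pathExp Φ mbar n (fun _ => 1) z = ∑ z', (L ^ n) z z' := by
  induction n generalizing z with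
  | zero => simp [pathExp, Matrix.one_apply]
  | succ n ih =>
    simp only [pathExp_one_succ, ih, pow_succ', Matrix.mul_apply, hL]
    rw [Finset.sum_comm]
    simp only [Finset.mul_sum]

theorem isUnit_det_of_specRad_lt {Z : Type*} [Fintype Z] [DecidableEq Z] [Nonempty Z]
    (L : Matrix Z Z ℝ) {s : ℝ} (hs : specRad L < s) : IsUnit (s • (1 : Matrix Z Z ℝ) - L).det := by
  set T := LinearMap.toContinuousLinearMap (Matrix.toEuclideanLin L) with hT
  have hfin : spectralRadius ℝ T ≠ ⊤ :=
    ((spectrum.spectralRadius_le_nnnorm T).trans_lt ENNReal.coe_lt_top).ne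
  have hlt : spectralRadius ℝ T < ‖s‖₊ := by
    rw [← ENNReal.toReal_lt_toReal hfin ENNReal.coe_ne_top]
    exact hs.trans_le (le_abs_self s)
  have hu : IsUnit (algebraMap ℝ _ s - T) := spectrum.mem_resolventSet_of_spectralRadius_lt hlt
  rw [isUnit_iff_ne_zero]
  intro hdet
  obtain ⟨v, hv, hLv⟩ := Matrix.exists_mulVec_eq_zero_iff.mpr hdet
  obtain ⟨U, hU⟩ := hu.exists_left_inv
  apply hv
  have hz : (algebraMap ℝ _ s - T) (WithLp.toLp 2 v) = 0 := by
    rw [Matrix.sub_mulVec, Matrix.smul_mulVec, Matrix.one_mulVec] at hLv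
    ext i
    simpa [hT, Algebra.algebraMap_eq_smul_one] using congrFun hLv i
  have := congrArg (fun A => A (WithLp.toLp 2 v)) hU
  simp only [mul_apply_eq_comp, hz, map_zero, one_apply_eq_self] at this
  simpa using congrArg WithLp.ofLp this.symm

section NonnegativeMatrix

variable {Z : Type*} [Fintype Z] [DecidableEq Z]

attribute [local instance] Matrix.linftyOpNormedRing Matrix.linftyOpNormedAlgebra

/-- If some power of `L / s` is a contraction, the entries of the truncated Neumann series at `s`
are bounded by those of the resolvent. -/
theorem neumann_partial_le_inv {L : Matrix Z Z ℝ} (hL : ∀ i j, 0 ≤ L i j) {s : ℝ} (hs : 0 < s)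
    (hdet : IsUnit (s • (1 : Matrix Z Z ℝ) - L).det) {n : ℕ} (hn : 0 < n) (hlt : ‖L ^ n‖ < s ^ n)
    (N : ℕ) (i j : Z) :
    ∑ k ∈ Finset.range N, (L ^ k) i j / s ^ k ≤ (s • (s • (1 : Matrix Z Z ℝ) - L)⁻¹) i j := by
  set B : Matrix Z Z ℝ := s⁻¹ • L with hB
  have hBk (k : ℕ) : (B ^ k) i j = (L ^ k) i j / s ^ k := by
    rw [hB, smul_pow, Matrix.smul_apply, smul_eq_mul, inv_pow, div_eq_inv_mul]
  have hBn : ‖B ^ n‖ < 1 := by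
    rw [hB, smul_pow, norm_smul, norm_pow, norm_inv, Real.norm_of_nonneg hs.le, inv_pow,
      inv_mul_lt_iff₀ (by positivity), mul_one]
    exact hlt
  have hgeom (K : ℕ) : ∑ k ∈ Finset.range K, B ^ k =
      s • (s • (1 : Matrix Z Z ℝ) - L)⁻¹ * (1 - B ^ K) := by
    have h1 : s • (1 - B) = s • (1 : Matrix Z Z ℝ) - L := by
      rw [hB, smul_sub, smul_smul, mul_inv_cancel₀ hs.ne', one_smul]
    rw [← mul_neg_geom_sum, ← mul_assoc, smul_mul_assoc, ← mul_smul_comm, h1,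
      Matrix.nonsing_inv_mul _ hdet, one_mul]
  have hlim : Tendsto (fun q : ℕ => (∑ k ∈ Finset.range (n * q), B ^ k)) atTop
      (𝓝 (s • (s • (1 : Matrix Z Z ℝ) - L)⁻¹)) := by
    simp only [hgeom, pow_mul]
    have := ((tendsto_pow_atTop_nhds_zero_of_norm_lt_one hBn).const_sub 1).const_mul
      (s • (s • (1 : Matrix Z Z ℝ) - L)⁻¹)
    rw [sub_zero, mul_one] at this
    exact this
  have hentry : Tendsto (fun q : ℕ => (∑ k ∈ Finset.range (n * q), B ^ k) i j) atTop
      (𝓝 ((s • (s • (1 : Matrix Z Z ℝ) - L)⁻¹) i j)) :=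
    ((continuous_id.matrix_elem i j).tendsto _).comp hlim
  refine ge_of_tendsto hentry ?_
  filter_upwards [eventually_ge_atTop N] with q hq
  simp only [Matrix.sum_apply, hBk]
  refine Finset.sum_le_sum_of_subset_of_nonneg
    (Finset.range_mono (hq.trans (Nat.le_mul_of_pos_left q hn))) fun k _ _ => ?_
  exact div_nonneg (Matrix.pow_apply_nonneg hL k i j) (by positivity)

theorem tendsto_of_neumann_partial_le {L : Matrix Z Z ℝ} (hL : ∀ i j, 0 ≤ L i j) {s : ℝ}
    (hs : 0 < s) {R : Matrix Z Z ℝ}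
    (hR : ∀ N i j, ∑ k ∈ Finset.range N, (L ^ k) i j / s ^ k ≤ R i j) (i j : Z) :
    Tendsto (fun k : ℕ => (L ^ k) i j / s ^ k) atTop (𝓝 0) :=
  (summable_of_sum_range_le (c := R i j)
    (fun k => div_nonneg (Matrix.pow_apply_nonneg hL k i j) (by positivity))
    (fun N => hR N i j)).tendsto_atTop_zero

/-- For an entrywise nonnegative matrix, invertibility of `t - L` for all real `t ≥ s` forces some
power of `L / s` to be a contraction. -/
theorem exists_norm_pow_lt {L : Matrix Z Z ℝ} (hL : ∀ i j, 0 ≤ L i j) {s : ℝ} (hs : 0 < s)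
    (hdet : ∀ t, s ≤ t → IsUnit (t • (1 : Matrix Z Z ℝ) - L).det) :
    ∃ n, 0 < n ∧ ‖L ^ n‖ < s ^ n := by
  by_contra hcon
  set S : Set ℝ := {t | 0 < t ∧ ∃ n, 0 < n ∧ ‖L ^ n‖ < t ^ n} with hS
  have hup {a b : ℝ} (ha : a ∈ S) (hab : a ≤ b) : b ∈ S := by
    obtain ⟨ha0, n, hn, hlt⟩ := ha
    exact ⟨ha0.trans_le hab, n, hn, hlt.trans_le (pow_le_pow_left₀ ha0.le hab n)⟩
  have hne : S.Nonempty :=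
    ⟨‖L‖ + 1, by positivity, 1, one_pos, by rw [pow_one, pow_one]; exact lt_add_one _⟩
  have hsS : ∀ a ∈ S, s ≤ a := by
    intro a ha
    by_contra! h
    exact hcon (hup ha h.le).2
  have hbdd : BddBelow S := ⟨s, hsS⟩
  set t := sInf S with ht
  have hst : s ≤ t := le_csInf hne hsS
  have ht0 : 0 < t := hs.trans_le hst
  have habove : ∀ a, t < a → a ∈ S := by
    intro a ha
    obtain ⟨b, hb, hba⟩ := exists_lt_of_csInf_lt hne ha
    exact hup hb hba.le
  have hbound : ∀ N i j, ∑ k ∈ Finset.range N, (L ^ k) i j / t ^ k ≤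
      (t • (t • (1 : Matrix Z Z ℝ) - L)⁻¹) i j := by
    intro N i j
    have hl : ContinuousAt (fun a : ℝ => ∑ k ∈ Finset.range N, (L ^ k) i j / a ^ k) t := by
      refine tendsto_finsetSum _ fun k _ => ?_
      exact continuousAt_const.div (continuousAt_id.pow k) (pow_ne_zero k ht0.ne')
    have hM : Continuous fun a : ℝ => a • (1 : Matrix Z Z ℝ) - L := by fun_prop
    have hr : ContinuousAt (fun a : ℝ => (a • (a • (1 : Matrix Z Z ℝ) - L)⁻¹) i j) t := by
      simp only [Matrix.inv_def, Matrix.smul_apply, smul_eq_mul, Ring.inverse_eq_inv']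
      refine continuousAt_id.mul ((hM.matrix_det.continuousAt.inv₀ (hdet t hst).ne_zero).mul ?_)
      exact (hM.matrix_adjugate.matrix_elem i j).continuousAt
    refine le_of_tendsto_of_tendsto (b := 𝓝[>] t) (hl.mono_left nhdsWithin_le_nhds)
      (hr.mono_left nhdsWithin_le_nhds) ?_
    filter_upwards [self_mem_nhdsWithin] with a ha
    obtain ⟨ha0, n, hn, hlt⟩ := habove a ha
    exact neumann_partial_le_inv hL ha0 (hdet a (hst.trans (le_of_lt ha))) hn hlt N i j
  have hlim : Tendsto (fun k : ℕ => (t ^ k)⁻¹ • L ^ k) atTop (𝓝 0) := by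
    refine tendsto_pi_nhds.mpr fun i => tendsto_pi_nhds.mpr fun j => ?_
    simpa [div_eq_inv_mul] using tendsto_of_neumann_partial_le hL ht0 hbound i j
  have hev := (hlim.norm.eventually_lt_const (by simp : ‖(0 : Matrix Z Z ℝ)‖ < 1)).and
    (eventually_gt_atTop 0)
  obtain ⟨n, hn1, hn⟩ := hev.exists
  rw [norm_smul, norm_inv, norm_pow, Real.norm_of_nonneg ht0.le,
    inv_mul_lt_iff₀ (by positivity), mul_one] at hn1
  have hnear : ∀ᶠ a in 𝓝[<] t, ‖L ^ n‖ < a ^ n ∧ 0 < a ∧ a < t :=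
    (((continuousAt_id.pow n).mono_left nhdsWithin_le_nhds).eventually_const_lt hn1).and
      ((eventually_nhdsWithin_of_eventually_nhds (lt_mem_nhds ht0)).and self_mem_nhdsWithin)
  obtain ⟨a, ha1, ha0, hat⟩ := hnear.exists
  exact hat.not_ge (csInf_le hbdd ⟨ha0, n, hn, ha1⟩)

theorem tendsto_pow_apply_div_pow {L : Matrix Z Z ℝ} (hL : ∀ i j, 0 ≤ L i j) {s : ℝ} (hs : 0 < s)
    (hdet : ∀ t, s ≤ t → IsUnit (t • (1 : Matrix Z Z ℝ) - L).det) (i j : Z) :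
    Tendsto (fun k : ℕ => (L ^ k) i j / s ^ k) atTop (𝓝 0) := by
  obtain ⟨n, hn, hlt⟩ := exists_norm_pow_lt hL hs hdet
  exact tendsto_of_neumann_partial_le hL hs
    (neumann_partial_le_inv hL hs (hdet s le_rfl) hn hlt) i j

end NonnegativeMatrix

/-- if `e^{−δ}·s(L) < 1` then there are `N` and `α ∈ (0,1)` with
`max_z E_z[∏_{t=1}^n e^{−δ}M_t] < αⁿ` for all `n ≥ N`; consequently
`D₁ = Σ_t max_z E_z[∏_{i=1}^t e^{−δ}M_i]` is finite (summable). -/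
theorem stmt2 {Z : Type*} [Fintype Z] [DecidableEq Z] [Nonempty Z]
    {Ωe : Type*} [MeasurableSpace Ωe] (με : Measure Ωe) [IsProbabilityMeasure με]
    (Φ : Z → Z → ℝ) (m : Z → Ωe → ℝ) (δ : ℝ) (hδ : 0 ≤ δ)
    (hΦnn : ∀ z z', 0 ≤ Φ z z') (hΦrow : ∀ z, ∑ z', Φ z z' = 1)
    (hirr : ∀ z z', ∃ n : ℕ, 0 < ((Matrix.of Φ) ^ n) z z')
    (hm : ∀ z ε, 0 ≤ m z ε) (hmint : ∀ z, Integrable (m z) με)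
    (L : Matrix Z Z ℝ)
    (hL : ∀ z z', L z z' = Φ z z' * ∫ ε, m z' ε ∂με)
    (hspec : Real.exp (-δ) * specRad L < 1) :
    (∃ N : ℕ, ∃ α : ℝ, 0 < α ∧ α < 1 ∧ ∀ n ≥ N,
      (⨆ z : Z, Real.exp (-δ * n) * pathExp Φ (fun z' => ∫ ε, m z' ε ∂με) n (fun _ => 1) z)
        < α ^ n) ∧
    Summable (fun t : ℕ =>
      ⨆ z : Z, Real.exp (-δ * t) * pathExp Φ (fun z' => ∫ ε, m z' ε ∂με) t (fun _ => 1) z) := by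
  set mbar : Z → ℝ := fun z' => ∫ ε, m z' ε ∂με
  have hLnn : ∀ i j, 0 ≤ L i j := fun i j => by
    rw [hL]
    exact mul_nonneg (hΦnn i j) (integral_nonneg (hm j))
  have hr0 : 0 ≤ specRad L := ENNReal.toReal_nonneg
  have hrlt : specRad L < Real.exp δ := by
    rwa [Real.exp_neg, inv_mul_lt_iff₀ (Real.exp_pos δ), mul_one] at hspec
  obtain ⟨s, hrs, hsδ⟩ := exists_between hrlt
  have hs : 0 < s := hr0.trans_lt hrs
  have hlim := tendsto_pow_apply_div_pow hLnn hs
    fun t ht => isUnit_det_of_specRad_lt L (hrs.trans_le ht)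
  have hsum (z : Z) : ∀ᶠ n : ℕ in atTop, ∑ z', (L ^ n) z z' / s ^ n < 1 := by
    have := tendsto_finsetSum Finset.univ fun z' _ => hlim z z'
    rw [Finset.sum_const_zero] at this
    exact this.eventually_lt_const one_pos
  obtain ⟨N, hN⟩ := eventually_atTop.mp (eventually_all.mpr hsum)
  have hα0 : 0 < Real.exp (-δ) * s := by positivity
  have hα1 : Real.exp (-δ) * s < 1 := by
    rwa [Real.exp_neg, inv_mul_lt_iff₀ (Real.exp_pos δ), mul_one]
  have hbound : ∀ n ≥ N, (⨆ z : Z, Real.exp (-δ * n) * pathExp Φ mbar n (fun _ => 1) z) <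
      (Real.exp (-δ) * s) ^ n := by
    intro n hn
    obtain ⟨z, hz⟩ := exists_eq_ciSup_of_finite
      (f := fun z : Z => Real.exp (-δ * n) * pathExp Φ mbar n (fun _ => 1) z)
    rw [← hz]
    have h := hN n hn z
    rw [← Finset.sum_div, div_lt_one (by positivity)] at h
    rw [pathExp_one_eq_pow Φ mbar L hL, mul_pow, ← Real.exp_nat_mul, mul_comm (n : ℝ)]
    exact mul_lt_mul_of_pos_left h (Real.exp_pos _)
  refine ⟨⟨N, _, hα0, hα1, hbound⟩, ?_⟩
  refine (summable_geometric_of_lt_one hα0.le hα1).of_norm_bounded_eventually_nat ?_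
  filter_upwards [eventually_ge_atTop N] with n hn
  rw [Real.norm_of_nonneg]
  · exact (hbound n hn).le
  · refine Real.iSup_nonneg fun z => mul_nonneg (Real.exp_pos _).le ?_
    rw [pathExp_one_eq_pow Φ mbar L hL]
    exact Finset.sum_nonneg fun z' _ => Matrix.pow_apply_nonneg hLnn n z z'
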